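/- Let n ≥ 1, 0 < α < n, 1 < p₁, p₂ < ∞. There is a constant C depending only on n, α, p₁, p₂ such that: whenever b ∈ BMO(ℝⁿ) with ‖b‖_* = 1, Q is a cube with center x_Q, f(y) = |Q|^{−1/p₁} sgn(b(y) − b_Q) χ_Q(y), g(y) = |Q| χ_{(2Q)^c}(y) |y − x_Q|^{−(n/p₂+n)}, and x ∈ (2nQ)^c, then |B_α((b − b_Q) f, g)(x)| ≤ C |Q|^{1/p₁' + 1} |x − x_Q|^{−2n − n/p₂ + α}, where 1/p₁' = 1 − 1/p₁. -/

import Mathlib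

open MeasureTheory Filter
open scoped ENNReal Topology

noncomputable section

/-- Euclidean space `ℝⁿ`. -/
abbrev Rn (n : ℕ) := EuclideanSpace ℝ (Fin n)

/-- Axis-parallel closed cube with center `c` and side length `r`. -/
def cube (n : ℕ) (c : Rn n) (r : ℝ) : Set (Rn n) := {y | ∀ i, |y i - c i| ≤ r / 2}

/-- Average of `b` over a set `Q`. -/
def avg (n : ℕ) (b : Rn n → ℝ) (Q : Set (Rn n)) : ℝ :=
  (volume Q).toReal⁻¹ * ∫ x in Q, b x

/-- Mean oscillation of `b` over a set `Q`. -/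
def osc (n : ℕ) (b : Rn n → ℝ) (Q : Set (Rn n)) : ℝ :=
  (volume Q).toReal⁻¹ * ∫ x in Q, |b x - avg n b Q|

/-- The BMO seminorm `‖b‖_*`, as an extended real number (supremum of the mean
oscillations over all cubes). -/
def bmoNorm (n : ℕ) (b : Rn n → ℝ) : ℝ≥0∞ :=
  ⨆ (c : Rn n) (r : {r : ℝ // 0 < r}), ENNReal.ofReal (osc n b (cube n c r.1))

/-- `b ∈ BMO(ℝⁿ)`. -/
def MemBMO (n : ℕ) (b : Rn n → ℝ) : Prop :=
  LocallyIntegrable b volume ∧ bmoNorm n b < ⊤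

/-- `b ∈ CMO(ℝⁿ)`: `b` lies in the closure of `C_c^∞(ℝⁿ)` in the BMO seminorm. -/
def MemCMO (n : ℕ) (b : Rn n → ℝ) : Prop :=
  LocallyIntegrable b volume ∧
  ∀ ε : ℝ, 0 < ε → ∃ g : Rn n → ℝ, ContDiff ℝ (⊤ : ℕ∞) g ∧ HasCompactSupport g ∧
    bmoNorm n (fun x => b x - g x) ≤ ENNReal.ofReal ε

/-- The bilinear fractional integral operator `B_α`. -/
def Bop (n : ℕ) (α : ℝ) (f g : Rn n → ℝ) (x : Rn n) : ℝ :=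
  ∫ y, f (x - y) * g (x + y) * ‖y‖ ^ (α - n)

/-- The first commutator `[b, B_α]₁`. -/
def commB (n : ℕ) (α : ℝ) (b f g : Rn n → ℝ) (x : Rn n) : ℝ :=
  ∫ y, (b x - b y) * f y * g ((2 : ℝ) • x - y) * ‖x - y‖ ^ (α - n)

/-- The bilinear fractional integral operator `I_α`. -/
def Iop (n : ℕ) (α : ℝ) (f₁ f₂ : Rn n → ℝ) (x : Rn n) : ℝ :=
  ∫ y₁, ∫ y₂, f₁ y₁ * f₂ y₂ * (‖x - y₁‖ ^ 2 + ‖x - y₂‖ ^ 2) ^ (α / 2 - n)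

/-- The iterated commutator `[Πb⃗, I_α]` with `b⃗ = (b, b)`. -/
def commI (n : ℕ) (α : ℝ) (b f₁ f₂ : Rn n → ℝ) (x : Rn n) : ℝ :=
  ∫ y₁, ∫ y₂, (b x - b y₁) * (b x - b y₂) * f₁ y₁ * f₂ y₂ *
    (‖x - y₁‖ ^ 2 + ‖x - y₂‖ ^ 2) ^ (α / 2 - n)

/-- The Muckenhoupt class `A_p`. -/
def MemAp (n : ℕ) (p : ℝ) (w : Rn n → ℝ) : Prop :=
  ∃ C : ℝ, ∀ (c : Rn n) (r : ℝ), 0 < r →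
    ((volume (cube n c r)).toReal⁻¹ * ∫ x in cube n c r, w x) *
      ((volume (cube n c r)).toReal⁻¹ * ∫ x in cube n c r, w x ^ (-(1 / (p - 1)))) ^ (p - 1) ≤ C

/-- The bilinear weight class `A_{P,q}` with `P = (p₁, p₂)`. -/
def MemAPq (n : ℕ) (p₁ p₂ q : ℝ) (w₁ w₂ : Rn n → ℝ) : Prop :=
  ∃ C : ℝ, ∀ (c : Rn n) (r : ℝ), 0 < r →
    ((volume (cube n c r)).toReal⁻¹ * ∫ x in cube n c r, w₁ x ^ q * w₂ x ^ q) *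
      ((volume (cube n c r)).toReal⁻¹ *
          ∫ x in cube n c r, w₁ x ^ (-(1 - 1 / p₁)⁻¹)) ^ (q * (1 - 1 / p₁)) *
      ((volume (cube n c r)).toReal⁻¹ *
          ∫ x in cube n c r, w₂ x ^ (-(1 - 1 / p₂)⁻¹)) ^ (q * (1 - 1 / p₂)) ≤ C

theorem isClosed_cube (n : ℕ) (c : Rn n) (r : ℝ) : IsClosed (cube n c r) := by
  have h : cube n c r = ⋂ i, {y : Rn n | |y i - c i| ≤ r / 2} := by
    ext y; simp [cube]
  rw [h]
  exact isClosed_iInter fun i => isClosed_le (by fun_prop) continuous_const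

theorem norm_sub_le_of_mem_cube {n : ℕ} (hn : 1 ≤ n) {c : Rn n} {r : ℝ} (hr : 0 < r) {u : Rn n}
    (hu : u ∈ cube n c r) : ‖u - c‖ ≤ n * r / 2 := by
  have hn' : (1 : ℝ) ≤ n := by exact_mod_cast hn
  rw [EuclideanSpace.norm_eq]
  refine Real.sqrt_le_iff.2 ⟨by positivity, ?_⟩
  calc ∑ i, ‖(u - c) i‖ ^ 2 ≤ ∑ _i : Fin n, (r / 2) ^ 2 := by
        refine Finset.sum_le_sum fun i _ => ?_
        exact pow_le_pow_left₀ (norm_nonneg _) (by simpa using hu i) 2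
    _ = n * (r / 2) ^ 2 := by simp
    _ ≤ (n * r / 2) ^ 2 := by
        have h : (n : ℝ) * (r / 2) ^ 2 ≤ n * n * (r / 2) ^ 2 := by
          gcongr
          nlinarith
        linarith [h, show (n * r / 2 : ℝ) ^ 2 = n * n * (r / 2) ^ 2 by ring]

theorem isCompact_cube {n : ℕ} (hn : 1 ≤ n) (c : Rn n) {r : ℝ} (hr : 0 < r) :
    IsCompact (cube n c r) :=
  (isCompact_closedBall c (n * r / 2)).of_isClosed_subset (isClosed_cube n c r) fun u hu => by
    simpa [dist_eq_norm] using norm_sub_le_of_mem_cube hn hr hu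

theorem volume_cube_toReal_pos {n : ℕ} (hn : 1 ≤ n) (c : Rn n) {r : ℝ} (hr : 0 < r) :
    0 < (volume (cube n c r)).toReal := by
  refine ENNReal.toReal_pos (ne_of_gt ?_) (isCompact_cube hn c hr).measure_lt_top.ne
  refine (Metric.measure_ball_pos volume c (half_pos hr)).trans_le (measure_mono fun u hu i => ?_)
  rw [mem_ball_iff_norm] at hu
  have h := PiLp.norm_apply_le (u - c) i
  simp only [PiLp.sub_apply, Real.norm_eq_abs] at h
  linarith

theorem integral_abs_sub_avg_le {n : ℕ} (hn : 1 ≤ n) {b : Rn n → ℝ} (hb : bmoNorm n b ≤ 1)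
    (c : Rn n) {r : ℝ} (hr : 0 < r) :
    ∫ y in cube n c r, |b y - avg n b (cube n c r)| ≤ (volume (cube n c r)).toReal := by
  have h : ENNReal.ofReal (osc n b (cube n c r)) ≤ 1 :=
    (le_iSup₂ (f := fun (c : Rn n) (r : {r : ℝ // 0 < r}) =>
      ENNReal.ofReal (osc n b (cube n c r.1))) c ⟨r, hr⟩).trans hb
  rw [ENNReal.ofReal_le_one, osc, inv_mul_le_iff₀ (volume_cube_toReal_pos hn c hr), mul_one] at h
  exact h

theorem Real.abs_sign_le_one (t : ℝ) : |Real.sign t| ≤ 1 := by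
  rcases Real.sign_apply_eq t with h | h | h <;> simp [h]

/-- Points of a cube are closer to its center `c` than half the distance from `c` to a point
outside the `2n`-fold dilate. -/
theorem norm_sub_le_half_of_mem_cube {n : ℕ} (hn : 1 ≤ n) {c : Rn n} {r : ℝ} (hr : 0 < r)
    {u x : Rn n} (hu : u ∈ cube n c r) (hx : x ∉ cube n c (2 * n * r)) :
    ‖u - c‖ ≤ ‖x - c‖ / 2 := by
  simp only [cube, Set.mem_ofPred_eq, not_forall, not_le] at hx
  obtain ⟨i, hi⟩ := hx
  have h := PiLp.norm_apply_le (x - c) i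
  simp only [PiLp.sub_apply, Real.norm_eq_abs] at h
  linarith [norm_sub_le_of_mem_cube hn hr hu]

/-- pointwise upper bound `|B_α((b - b_Q)f, g)(x)| ≲ |Q|^{1/p₁'+1}
|x - x_Q|^{-2n - n/p₂ + α}` for `x ∈ (2nQ)^c`. -/
theorem statement6 (n : ℕ) (hn : 1 ≤ n) (α p₁ p₂ : ℝ)
    (hα : 0 < α) (hαn : α < n) (hp₁ : 1 < p₁) (hp₂ : 1 < p₂) :
    ∃ C : ℝ, ∀ (b : Rn n → ℝ) (c : Rn n) (r : ℝ), 0 < r →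
      LocallyIntegrable b volume → bmoNorm n b = 1 →
      ∀ x : Rn n, x ∉ cube n c (2 * n * r) →
        |Bop n α
            ((cube n c r).indicator fun y =>
              (b y - avg n b (cube n c r)) *
                ((volume (cube n c r)).toReal ^ (-(1 / p₁)) *
                  Real.sign (b y - avg n b (cube n c r))))
            ((cube n c (2 * r))ᶜ.indicator fun y =>
              (volume (cube n c r)).toReal * ‖y - c‖ ^ (-(↑n / p₂ + ↑n)))
            x| ≤
          C * (volume (cube n c r)).toReal ^ (1 - 1 / p₁ + 1) *
            ‖x - c‖ ^ (-(2 * n) - n / p₂ + α) := by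
  refine ⟨2 ^ (n - α), fun b c r hr hb hb1 x hx => ?_⟩
  have hV := volume_cube_toReal_pos hn c hr
  have hI := integral_abs_sub_avg_le hn hb1.le c hr
  have hsmall : ∀ u ∈ cube n c r, ‖u - c‖ ≤ ‖x - c‖ / 2 := fun u hu =>
    norm_sub_le_half_of_mem_cube hn hr hu hx
  have hR : 0 < ‖x - c‖ := by
    refine norm_pos_iff.2 fun h => hx ?_
    rw [sub_eq_zero.1 h]
    intro i
    simp only [sub_self, abs_zero]
    positivity
  set Q := cube n c r
  set m := avg n b Q
  set V := (volume Q).toReal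
  set R := ‖x - c‖
  set K := V ^ (-(1 / p₁)) * (V * R ^ (-(↑n / p₂ + ↑n) : ℝ)) * (R / 2) ^ (α - n)
  have hQ : MeasurableSet Q := (isClosed_cube n c r).measurableSet
  have hφ : Integrable (Q.indicator fun u => |b u - m|) := by
    rw [integrable_indicator_iff hQ]
    have hQc : IsCompact Q := isCompact_cube hn c hr
    exact ((hb.integrableOn_isCompact hQc).sub
      (integrableOn_const hQc.measure_lt_top.ne)).abs
  have hbound : |Bop n α (Q.indicator fun y => (b y - m) * (V ^ (-(1 / p₁)) * Real.sign (b y - m)))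
      ((cube n c (2 * r))ᶜ.indicator fun y => V * ‖y - c‖ ^ (-(↑n / p₂ + ↑n) : ℝ)) x| ≤
      ∫ y, (Q.indicator fun u => |b u - m|) (x - y) * K := by
    rw [← Real.norm_eq_abs]
    refine norm_integral_le_of_norm_le ((hφ.comp_sub_left x).mul_const K) (.of_forall fun y => ?_)
    by_cases hy : x - y ∈ Q
    · have hs := hsmall _ hy
      rw [Set.indicator_of_mem hy, Set.indicator_of_mem hy]
      have h1 : R / 2 ≤ ‖y‖ := by
        have h := norm_sub_norm_le (x - c) (x - y - c)
        rw [show x - c - (x - y - c) = y by abel] at h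
        linarith
      have h2 : R ≤ ‖x + y - c‖ := by
        have h := norm_sub_norm_le ((2 : ℝ) • (x - c)) (x - y - c)
        rw [show (2 : ℝ) • (x - c) - (x - y - c) = x + y - c by rw [two_smul]; abel,
          norm_smul, Real.norm_two] at h
        linarith
      have hg : ‖(cube n c (2 * r))ᶜ.indicator
          (fun y => V * ‖y - c‖ ^ (-(↑n / p₂ + ↑n) : ℝ)) (x + y)‖ ≤
          V * R ^ (-(↑n / p₂ + ↑n) : ℝ) := by
        refine (norm_indicator_le_norm_self _ _).trans ?_
        rw [Real.norm_of_nonneg (by positivity)]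
        refine mul_le_mul_of_nonneg_left (Real.rpow_le_rpow_of_nonpos hR h2 ?_) hV.le
        exact neg_nonpos.2 (by positivity)
      have hk : ‖‖y‖ ^ (α - n)‖ ≤ (R / 2) ^ (α - n) := by
        rw [Real.norm_of_nonneg (by positivity)]
        exact Real.rpow_le_rpow_of_nonpos (half_pos hR) h1 (by linarith)
      have hf : ‖(b (x - y) - m) * (V ^ (-(1 / p₁)) * Real.sign (b (x - y) - m))‖ ≤
          |b (x - y) - m| * V ^ (-(1 / p₁)) := by
        rw [norm_mul, norm_mul, Real.norm_eq_abs, Real.norm_of_nonneg (by positivity),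
          Real.norm_eq_abs]
        exact mul_le_mul_of_nonneg_left
          (mul_le_of_le_one_right (by positivity) (Real.abs_sign_le_one _)) (abs_nonneg _)
      rw [norm_mul, norm_mul]
      calc _ ≤ |b (x - y) - m| * V ^ (-(1 / p₁)) * (V * R ^ (-(↑n / p₂ + ↑n) : ℝ)) *
            (R / 2) ^ (α - n) := by gcongr
        _ = _ := by simp only [K]; ring
    · simp [Set.indicator_of_notMem hy]
  refine hbound.trans ?_
  rw [integral_mul_const, integral_sub_left_eq_self (Q.indicator fun u => |b u - m|) volume x,
    integral_indicator hQ]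
  calc _ ≤ V * K := mul_le_mul_of_nonneg_right hI (by positivity)
    _ = _ := by
      have e1 : V ^ (1 - 1 / p₁ + 1) = V ^ (-(1 / p₁)) * V * V := by
        rw [show 1 - 1 / p₁ + 1 = -(1 / p₁) + 1 + 1 by ring, Real.rpow_add_one hV.ne',
          Real.rpow_add_one hV.ne']
      have e2 : R ^ (-(2 * n) - n / p₂ + α) = R ^ (-(↑n / p₂ + ↑n) : ℝ) * R ^ (α - n) := by
        rw [← Real.rpow_add hR]
        ring_nf
      have e3 : (R / 2) ^ (α - n) = R ^ (α - n) * 2 ^ (n - α) := by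
        rw [Real.div_rpow hR.le zero_le_two, div_eq_mul_inv, ← Real.rpow_neg zero_le_two, neg_sub]
      simp only [K]
      rw [e1, e2, e3]
      ring
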